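/- arXiv:1305.2187 — 2 statements merged into one kernel-verified Lean document; each statement's English description precedes it below -/
import Mathlib

section
/- Let 𝓗 be a complex Hilbert space, V a bounded self-adjoint operator, K a positive bounded operator, and G a bounded operator on 𝓗 satisfying G − G* = 2iK, and assume 1 − VG is invertible. Then with T = (1 − VG)⁻¹V one has 2·T K T* + iT − iT* = 0. -/
noncomputable section

open ContinuousLinearMap

/-- Let `V` be bounded self-adjoint, `K` positive, and `G` bounded with
`G - G* = 2iK`; assume `1 - V G` invertible and set `T = (1 - V G)⁻¹ V`. Then
`2 T K T* + iT - iT* = 0`. -/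
theorem stmt12 {𝓗 : Type*} [NormedAddCommGroup 𝓗] [InnerProductSpace ℂ 𝓗] [CompleteSpace 𝓗]
    (V K G : 𝓗 →L[ℂ] 𝓗) (hV : IsSelfAdjoint V)
    (hK : K.IsPositive)
    (hG : G - star G = (2 * Complex.I) • K)
    (hVG : IsUnit (1 - V * G)) :
    ∀ T : 𝓗 →L[ℂ] 𝓗, T = Ring.inverse (1 - V * G) * V →
      (2 : ℂ) • (T * K * star T) + Complex.I • T - Complex.I • star T = 0 := by
  intro T hT
  have hB : Ring.inverse (1 - V * G) * (1 - V * G) = 1 := Ring.inverse_mul_cancel _ hVG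
  generalize Ring.inverse (1 - V * G) = B at hT hB
  have hV' : star V = V := hV
  have hB' : (1 - star G * V) * star B = 1 := by
    have h := congrArg star hB
    simpa only [star_mul, star_sub, star_one, hV'] using h
  have hTs : star T = V * star B := by rw [hT, star_mul, hV']
  have h1 : B * V * G = B - 1 := by
    rw [← hB]; noncomm_ring
  have h2 : star G * (V * star B) = star B - 1 := by
    rw [← hB']; noncomm_ring
  have key : T * (G - star G) * star T = T - star T := by
    rw [mul_sub, sub_mul, mul_assoc T (star G), hTs, h2, hT, h1]
    noncomm_ring
  rw [hG, mul_smul_comm, smul_mul_assoc] at key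
  have h3 : (2 : ℂ) • (T * K * star T) = (-Complex.I) • (T - star T) := by
    rw [← key, smul_smul]
    congr 1
    linear_combination 2 * Complex.I_mul_I
  rw [h3, neg_smul, smul_sub]
  abel
end
end

section
/- For every a ∈ ℝ and each sign s ∈ {+1, −1}, the limit as ε ↓ 0 of (1/(iπ)) ∫_ℝ e^{iau}/(sinh(u) − s·iε) du exists and equals s + tanh(πa/2); here for each ε > 0 the integrand is absolutely integrable over ℝ. -/
noncomputable section

open MeasureTheory Filter

lemma aux_coth (a : ℝ) (ha : a ≠ 0) :
    HasSum (fun n : ℕ => 2 * a / (a ^ 2 + ((n : ℝ) + 1) ^ 2))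
      (Real.pi * (Real.cosh (Real.pi * a) / Real.sinh (Real.pi * a)) - 1 / a) := by
  have hz : ((a : ℂ) * Complex.I) ∈ Complex.integerComplement := by
    rintro ⟨n, hn⟩
    have := congrArg Complex.im hn
    simp at this
    exact ha this.symm
  have h1 := (summable_cotTerm hz).hasSum
  have h2 := cot_series_rep' hz
  rw [← h2] at h1
  have h3 := h1.mul_left Complex.I
  have haC : (a : ℂ) ≠ 0 := by exact_mod_cast ha
  rw [← Complex.hasSum_ofReal] 
  have hsh : Real.sinh (Real.pi * a) ≠ 0 := by
    rw [Ne, Real.sinh_eq_zero]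
    exact mul_ne_zero Real.pi_ne_zero ha
  have E1 : (fun n : ℕ => ((2 * a / (a ^ 2 + ((n : ℝ) + 1) ^ 2) : ℝ) : ℂ)) =
      fun n : ℕ => Complex.I * cotTerm (a * Complex.I) n := by
    funext n
    rw [cotTerm_identity hz]
    have h4 : ((a : ℂ) * Complex.I + (n + 1)) * ((a : ℂ) * Complex.I - (n + 1))
        = -((a : ℂ) ^ 2 + ((n : ℂ) + 1) ^ 2) := by
      ring_nf; rw [Complex.I_sq]; ring
    rw [h4]
    push_cast
    have h5 : ((a : ℂ) ^ 2 + ((n : ℂ) + 1) ^ 2) ≠ 0 := by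
      have : (a ^ 2 + ((n : ℝ) + 1) ^ 2) ≠ 0 := by positivity
      exact_mod_cast this
    field_simp
    rw [Complex.I_sq]; ring
  have E2 : ((Real.pi * (Real.cosh (Real.pi * a) / Real.sinh (Real.pi * a)) - 1 / a : ℝ) : ℂ) =
      Complex.I * (Real.pi * Complex.cot (Real.pi * (a * Complex.I)) - 1 / (a * Complex.I)) := by
    rw [← mul_assoc, Complex.cot, Complex.cos_mul_I, Complex.sin_mul_I]
    push_cast
    have hsh' : Complex.sinh (Real.pi * a) ≠ 0 := by exact_mod_cast hsh
    field_simp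
  rw [E1, E2]
  exact h3

lemma aux_odd (a : ℝ) (ha : a ≠ 0) :
    HasSum (fun n : ℕ => 4 * a / (a ^ 2 + (2 * (n : ℝ) + 1) ^ 2))
      (Real.pi * Real.tanh (Real.pi * a / 2)) := by
  have hA := (aux_coth a ha).mul_left 2
  have hB := aux_coth (a / 2) (by simpa using ha)
  set f : ℕ → ℝ := fun n => 2 * (2 * a / (a ^ 2 + ((n : ℝ) + 1) ^ 2)) with hf
  have hS : Summable (fun n => f (2 * n)) :=
    hA.summable.comp_injective (i := fun n : ℕ => 2 * n) (fun x y h => by simpa using h)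
  have hB' : HasSum (fun n => f (2 * n + 1)) (Real.pi * (Real.cosh (Real.pi * (a / 2)) / Real.sinh (Real.pi * (a / 2))) - 1 / (a / 2)) := by
    convert hB using 1
    funext n
    simp only [hf]
    push_cast
    field_simp
    ring
  have h := (hS.hasSum.even_add_odd hB').unique hA
  have h2 := hS.hasSum
  have e : (∑' n, f (2 * n)) = Real.pi * Real.tanh (Real.pi * a / 2) := by
    have : (∑' n, f (2 * n)) = 2 * (Real.pi * (Real.cosh (Real.pi * a) / Real.sinh (Real.pi * a)) - 1 / a) - (Real.pi * (Real.cosh (Real.pi * (a / 2)) / Real.sinh (Real.pi * (a / 2))) - 1 / (a / 2)) := by linarith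
    rw [this, Real.tanh_eq_sinh_div_cosh]
    have hy : Real.pi * a = 2 * (Real.pi * a / 2) := by ring
    rw [hy, ← mul_div_assoc Real.pi a 2]
    set y := Real.pi * a / 2
    have hy0 : y ≠ 0 := by
      simp only [y]; have := Real.pi_ne_zero; positivity
    rw [show 2 * y / 2 = y by ring]
    have hs : Real.sinh y ≠ 0 := by rwa [Ne, Real.sinh_eq_zero]
    have hc : Real.cosh y ≠ 0 := (Real.cosh_pos y).ne'
    rw [Real.cosh_two_mul, Real.sinh_two_mul]
    have := Real.cosh_sq y
    field_simp
    ring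
  rw [e] at h2
  convert h2 using 1
  funext n
  simp only [hf]
  push_cast
  ring

lemma aux_int_term (a b : ℝ) (hb : 0 < b) :
    IntegrableOn (fun u : ℝ => Real.exp (-b * u) * Real.sin (a * u)) (Set.Ioi 0) ∧
    ∫ u in Set.Ioi (0 : ℝ), Real.exp (-b * u) * Real.sin (a * u) = a / (a ^ 2 + b ^ 2) := by
  have hre : (-(b : ℂ) + a * Complex.I).re < 0 := by simpa using hb
  have hi := integrableOn_exp_mul_complex_Ioi hre 0
  have he := integral_exp_mul_complex_Ioi hre 0
  have hfun : ∀ u : ℝ, (Complex.exp ((-(b : ℂ) + a * Complex.I) * u)).im =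
      Real.exp (-b * u) * Real.sin (a * u) := by
    intro u
    rw [Complex.exp_im]; simp
  constructor
  · have := hi.im
    refine Integrable.congr this (Eventually.of_forall fun u => ?_)
    exact hfun u
  · have h := integral_im hi
    simp only [RCLike.im_to_complex, hfun] at h
    rw [h, he]
    have h0 : (a ^ 2 + b ^ 2) ≠ 0 := by positivity
    simp [Complex.div_im, Complex.normSq_apply]
    field_simp
    ring

lemma aux_int_norm (a b : ℝ) (hb : 0 < b) :
    ∫ u in Set.Ioi (0 : ℝ), ‖Real.exp (-b * u) * Real.sin (a * u)‖ ≤ |a| * (1 / b ^ 2) := by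
  have h := Real.integral_rpow_mul_exp_neg_mul_Ioi (a := 2) (r := b) (by norm_num) hb
  have hint : IntegrableOn (fun u : ℝ => u * Real.exp (-b * u)) (Set.Ioi 0) := by
    have := integrableOn_rpow_mul_exp_neg_mul_rpow (p := 1) (s := 1) (b := b) (by norm_num) (by norm_num) hb
    simpa using this
  have h' : ∫ u in Set.Ioi (0 : ℝ), u * Real.exp (-b * u) = 1 / b ^ 2 := by
    rw [show ((2 : ℝ) - 1) = 1 by norm_num] at h
    simp only [Real.rpow_one, Real.Gamma_two, mul_one] at h
    rw [Real.rpow_two] at h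
    simpa [one_div, neg_mul] using h
  rw [← h', ← integral_const_mul]
  refine setIntegral_mono_on (aux_int_term a b hb).1.norm (hint.const_mul _) measurableSet_Ioi ?_
  intro u hu
  have hu' : 0 < u := hu
  rw [norm_mul, Real.norm_eq_abs, Real.norm_eq_abs, abs_of_pos (Real.exp_pos _)]
  have : |Real.sin (a * u)| ≤ |a| * u := by
    have := Real.abs_sin_le_abs (x := a * u)
    rwa [abs_mul, abs_of_pos hu'] at this
  nlinarith [Real.exp_pos (-b * u)]

lemma aux_Ioi (a : ℝ) (ha : a ≠ 0) :
    ∫ u in Set.Ioi (0 : ℝ), Real.sin (a * u) / Real.sinh u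
      = Real.pi / 2 * Real.tanh (Real.pi * a / 2) := by
  have hb : ∀ n : ℕ, (0 : ℝ) < 2 * n + 1 := fun n => by positivity
  have h := hasSum_integral_of_summable_integral_norm (μ := volume.restrict (Set.Ioi (0:ℝ)))
    (F := fun (n : ℕ) (u : ℝ) => 2 * (Real.exp (-(2 * n + 1) * u) * Real.sin (a * u)))
    (fun n => ((aux_int_term a _ (hb n)).1.const_mul 2)) (by
      refine Summable.of_nonneg_of_le (fun n => integral_nonneg fun u => norm_nonneg _) (fun n => ?_)
        (f := fun n : ℕ => 2 * (|a| * (1 / (n + 1 : ℝ) ^ 2))) ?_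
      · simp_rw [norm_mul (2 : ℝ)]
        rw [integral_const_mul, Real.norm_ofNat]
        refine mul_le_mul_of_nonneg_left ((aux_int_norm a _ (hb n)).trans ?_) (by norm_num)
        have : (n + 1 : ℝ) ≤ 2 * n + 1 := by linarith [(Nat.cast_nonneg n : (0:ℝ) ≤ n)]
        gcongr
      · refine Summable.mul_left _ (Summable.mul_left _ ?_)
        have := (summable_nat_add_iff (f := fun n : ℕ => 1 / (n : ℝ) ^ 2) 1).2
          (Real.summable_one_div_nat_pow.2 (by norm_num))
        simpa using this)
  have e1 : ∀ n : ℕ, ∫ u in Set.Ioi (0:ℝ), 2 * (Real.exp (-(2 * n + 1) * u) * Real.sin (a * u)) =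
      1 / 2 * (4 * a / (a ^ 2 + (2 * (n : ℝ) + 1) ^ 2)) := by
    intro n
    rw [integral_const_mul, (aux_int_term a _ (hb n)).2]
    ring
  simp_rw [e1] at h
  have h2 := h.unique ((aux_odd a ha).mul_left (1 / 2))
  rw [show Real.pi / 2 * Real.tanh (Real.pi * a / 2) = 1 / 2 * (Real.pi * Real.tanh (Real.pi * a / 2)) by ring, ← h2]
  refine setIntegral_congr_fun measurableSet_Ioi fun u hu => ?_
  have hu : 0 < u := hu
  have hq : Real.exp (-2 * u) < 1 := by rw [Real.exp_lt_one_iff]; linarith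
  have hg := hasSum_geometric_of_lt_one (Real.exp_pos (-2 * u)).le hq
  have hg2 := hg.mul_left (2 * Real.exp (-u) * Real.sin (a * u))
  have e2 : (fun n : ℕ => 2 * (Real.exp (-(2 * n + 1) * u) * Real.sin (a * u))) =
     (fun n : ℕ => 2 * Real.exp (-u) * Real.sin (a * u) * Real.exp (-2 * u) ^ n) := by
    funext n
    rw [← Real.exp_nat_mul, show -(2 * n + 1) * u = -u + n * (-2 * u) by ring, Real.exp_add]
    ring
  rw [e2, hg2.tsum_eq, Real.sinh_eq, show -2 * u = -u + -u by ring, Real.exp_add, Real.exp_neg]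
  have hE : 1 < Real.exp u := Real.one_lt_exp_iff.2 hu
  have h3 : Real.exp u ^ 2 - 1 ≠ 0 := by nlinarith
  have h4 : Real.exp u - (Real.exp u)⁻¹ ≠ 0 := by
    rw [show Real.exp u - (Real.exp u)⁻¹ = (Real.exp u ^ 2 - 1) / Real.exp u by field_simp]
    positivity
  have h5 : 1 - (Real.exp u)⁻¹ * (Real.exp u)⁻¹ ≠ 0 := by
    rw [show 1 - (Real.exp u)⁻¹ * (Real.exp u)⁻¹ = (Real.exp u ^ 2 - 1) / Real.exp u ^ 2 by field_simp]
    positivity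
  field_simp

lemma aux_full (a : ℝ) :
    ∫ u : ℝ, Real.sin (a * u) / Real.sinh u = Real.pi * Real.tanh (Real.pi * a / 2) := by
  rcases eq_or_ne a 0 with rfl | ha
  · simp
  have h := integral_comp_abs (f := fun u => Real.sin (a * u) / Real.sinh u)
  rw [aux_Ioi a ha] at h
  rw [show Real.pi * Real.tanh (Real.pi * a / 2) = 2 * (Real.pi / 2 * Real.tanh (Real.pi * a / 2)) by ring, ← h]
  congr 1
  funext u
  rcases abs_choice u with h | h <;> rw [h]
  simp [neg_div_neg_eq]

lemma aux_cosh_int : Integrable (fun u : ℝ => (Real.cosh u)⁻¹) := by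
  refine Integrable.mono' (integrable_inv_one_add_sq.const_mul 2) ?_ (Eventually.of_forall fun u => ?_)
  · exact (Real.continuous_cosh.inv₀ fun u => (Real.cosh_pos u).ne').aestronglyMeasurable
  · rw [Real.norm_eq_abs, abs_of_pos (inv_pos.2 (Real.cosh_pos u))]
    have h1 : (u / 2) ^ 2 ≤ Real.sinh (u / 2) ^ 2 := by
      rw [sq_le_sq, Real.abs_sinh]
      exact Real.self_le_sinh_iff.2 (abs_nonneg _)
    have h2 : Real.cosh u = 1 + 2 * Real.sinh (u / 2) ^ 2 := by
      conv_lhs => rw [show u = 2 * (u / 2) by ring]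
      rw [Real.cosh_two_mul, Real.cosh_sq]; ring
    rw [← div_eq_mul_inv, inv_eq_one_div, div_le_div_iff₀ (Real.cosh_pos u) (by positivity)]
    nlinarith

lemma aux_den (ε u : ℝ) (hε : 0 < ε) : 0 < Real.sinh u ^ 2 + ε ^ 2 := by positivity

lemma aux_bound_sin (a u : ℝ) : |Real.sin (a * u)| * Real.cosh u ≤ (|a| + 1) * |Real.sinh u| := by
  have h1 : Real.cosh u ≤ 1 + |Real.sinh u| := by
    refine abs_le_of_sq_le_sq' ?_ (by positivity) |>.2
    nlinarith [Real.cosh_sq u, sq_abs (Real.sinh u), abs_nonneg (Real.sinh u)]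
  have h2 : |u| ≤ |Real.sinh u| := by
    rw [Real.abs_sinh]; exact Real.self_le_sinh_iff.2 (abs_nonneg _)
  have h3 : |Real.sin (a * u)| ≤ |a| * |u| := by
    rw [← abs_mul]; exact Real.abs_sin_le_abs
  have h4 := Real.abs_sin_le_one (a * u)
  have h5 := abs_nonneg (Real.sin (a * u))
  nlinarith [mul_le_mul_of_nonneg_left h1 h5, mul_le_mul_of_nonneg_left h2 (abs_nonneg a),
    mul_le_mul_of_nonneg_right h4 (abs_nonneg (Real.sinh u))]

lemma aux_bound2 (a ε u : ℝ) (hε : 0 < ε) :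
    ‖Real.sin (a * u) * Real.sinh u / (Real.sinh u ^ 2 + ε ^ 2)‖ ≤ (|a| + 1) * (Real.cosh u)⁻¹ := by
  have hd := aux_den ε u hε
  rw [norm_div, norm_mul, Real.norm_eq_abs, Real.norm_eq_abs, Real.norm_eq_abs, abs_of_pos hd,
    ← div_eq_mul_inv, div_le_div_iff₀ hd (Real.cosh_pos u)]
  have := mul_le_mul_of_nonneg_right (aux_bound_sin a u) (abs_nonneg (Real.sinh u))
  have h3 : 0 ≤ (|a| + 1) * ε ^ 2 := by positivity
  rw [mul_assoc (|a| + 1), abs_mul_abs_self] at this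
  linarith

lemma aux_meas2 (a ε : ℝ) (hε : 0 < ε) :
    Continuous (fun u : ℝ => Real.sin (a * u) * Real.sinh u / (Real.sinh u ^ 2 + ε ^ 2)) := by
  refine Continuous.div (by fun_prop) (by fun_prop) fun u => (aux_den ε u hε).ne'

lemma aux_lim2 (a : ℝ) : Tendsto (fun ε : ℝ =>
    ∫ u : ℝ, Real.sin (a * u) * Real.sinh u / (Real.sinh u ^ 2 + ε ^ 2))
    (nhdsWithin 0 (Set.Ioi 0)) (nhds (Real.pi * Real.tanh (Real.pi * a / 2))) := by
  rw [← aux_full]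
  refine tendsto_integral_filter_of_dominated_convergence
    (fun u => (|a| + 1) * (Real.cosh u)⁻¹) ?_ ?_ (aux_cosh_int.const_mul _) ?_
  · filter_upwards [self_mem_nhdsWithin] with ε hε
    exact (aux_meas2 a ε hε).aestronglyMeasurable
  · filter_upwards [self_mem_nhdsWithin] with ε hε
    exact Eventually.of_forall fun u => aux_bound2 a ε u hε
  · refine Eventually.of_forall fun u => ?_
    rcases eq_or_ne (Real.sinh u) 0 with h | h
    · simp [h]
    · have : Real.sin (a * u) / Real.sinh u =
          Real.sin (a * u) * Real.sinh u / (Real.sinh u ^ 2 + 0 ^ 2) := by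
        field_simp; simp
      rw [this]
      refine Tendsto.mono_left ?_ nhdsWithin_le_nhds
      refine Tendsto.div tendsto_const_nhds ?_ (by positivity)
      exact Continuous.tendsto (by fun_prop) 0

lemma aux_subst (a ε : ℝ) (hε : 0 < ε) :
    ∫ u : ℝ, Real.cos (a * u) * ε / (Real.sinh u ^ 2 + ε ^ 2) =
    ∫ t : ℝ, Real.cos (a * Real.arsinh (ε * t)) / (Real.sqrt (1 + (ε * t) ^ 2)) * (1 + t ^ 2)⁻¹ := by
  have h := integral_image_eq_integral_abs_deriv_smul (s := Set.univ) MeasurableSet.univ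
    (f := fun u => Real.sinh u / ε) (f' := fun u => Real.cosh u / ε)
    (fun u _ => ((Real.hasDerivAt_sinh u).div_const ε).hasDerivWithinAt)
    (fun x _ y _ hxy => by
      have : Real.sinh x = Real.sinh y := by
        simp only [] at hxy
        field_simp at hxy
        exact hxy
      exact Real.sinh_injective this)
    (fun t => Real.cos (a * Real.arsinh (ε * t)) / (Real.sqrt (1 + (ε * t) ^ 2)) * (1 + t ^ 2)⁻¹)
  have hs : (fun u => Real.sinh u / ε) '' Set.univ = Set.univ := by
    rw [Set.image_univ, Set.range_eq_univ]
    intro t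
    exact ⟨Real.arsinh (ε * t), by simp [Real.sinh_arsinh]; field_simp⟩
  rw [hs, setIntegral_univ, setIntegral_univ] at h
  rw [h]
  congr 1
  funext u
  have hc := Real.cosh_pos u
  rw [show ε * (Real.sinh u / ε) = Real.sinh u by field_simp, Real.arsinh_sinh,
    abs_of_pos (by positivity), show 1 + Real.sinh u ^ 2 = Real.cosh u ^ 2 by rw [Real.cosh_sq]; ring,
    Real.sqrt_sq hc.le, smul_eq_mul]
  have := aux_den ε u hε
  have h2 : 1 + (Real.sinh u / ε) ^ 2 = (Real.sinh u ^ 2 + ε ^ 2) / ε ^ 2 := by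
    field_simp; ring
  rw [h2]
  field_simp

lemma aux_lim1 (a : ℝ) : Tendsto (fun ε : ℝ =>
    ∫ u : ℝ, Real.cos (a * u) * ε / (Real.sinh u ^ 2 + ε ^ 2))
    (nhdsWithin 0 (Set.Ioi 0)) (nhds Real.pi) := by
  have hcont : ∀ ε : ℝ, Continuous fun t : ℝ => Real.cos (a * Real.arsinh (ε * t)) /
      (Real.sqrt (1 + (ε * t) ^ 2)) := fun ε =>
    Continuous.div (Real.continuous_cos.comp (continuous_const.mul
      (Real.continuous_arsinh.comp (by fun_prop)))) (by fun_prop) fun t => (Real.sqrt_pos.2 (by positivity)).ne'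
  have hcont2 : ∀ t : ℝ, Continuous fun ε : ℝ => Real.cos (a * Real.arsinh (ε * t)) /
      (Real.sqrt (1 + (ε * t) ^ 2)) := fun t =>
    Continuous.div (Real.continuous_cos.comp (continuous_const.mul
      (Real.continuous_arsinh.comp (by fun_prop)))) (by fun_prop) fun ε => (Real.sqrt_pos.2 (by positivity)).ne'
  have h : Tendsto (fun ε : ℝ => ∫ t : ℝ, Real.cos (a * Real.arsinh (ε * t)) /
      (Real.sqrt (1 + (ε * t) ^ 2)) * (1 + t ^ 2)⁻¹)
      (nhdsWithin 0 (Set.Ioi 0)) (nhds (∫ t : ℝ, (1 + t ^ 2)⁻¹)) := by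
    refine tendsto_integral_filter_of_dominated_convergence
      (fun t => (1 + t ^ 2)⁻¹) ?_ ?_ integrable_inv_one_add_sq ?_
    · refine Eventually.of_forall fun ε => ?_
      exact ((hcont ε).aestronglyMeasurable).mul integrable_inv_one_add_sq.aestronglyMeasurable
    · refine Eventually.of_forall fun ε => Eventually.of_forall fun t => ?_
      rw [norm_mul, Real.norm_of_nonneg (by positivity : 0 ≤ (1 + t ^ 2)⁻¹)]
      refine mul_le_of_le_one_left (by positivity) ?_
      rw [norm_div, Real.norm_eq_abs, Real.norm_of_nonneg (Real.sqrt_nonneg _)]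
      have h1 : 1 ≤ Real.sqrt (1 + (ε * t) ^ 2) := by
        rw [Real.one_le_sqrt]; nlinarith [sq_nonneg (ε * t)]
      rw [div_le_one (by linarith)]
      exact (Real.abs_cos_le_one _).trans h1
    · refine Eventually.of_forall fun t => ?_
      refine Tendsto.mono_left ?_ nhdsWithin_le_nhds
      have := ((hcont2 t).tendsto 0).mul_const ((1 + t ^ 2)⁻¹)
      simpa using this
  rw [integral_univ_inv_one_add_sq] at h
  refine h.congr' ?_
  filter_upwards [self_mem_nhdsWithin] with ε hε
  exact (aux_subst a ε hε).symm

lemma aux_inv (ε u : ℝ) (hε : 0 < ε) :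
    (Real.sinh u ^ 2 + ε ^ 2)⁻¹ ≤ (1 + 1 / ε ^ 2) * (Real.cosh u ^ 2)⁻¹ := by
  have := aux_den ε u hε
  have hc := Real.cosh_pos u
  rw [← div_eq_mul_inv, inv_eq_one_div, div_le_div_iff₀ this (by positivity), Real.cosh_sq]
  have : (1 + 1 / ε ^ 2) * (Real.sinh u ^ 2 + ε ^ 2) =
    Real.sinh u ^ 2 + 1 + ε ^ 2 + Real.sinh u ^ 2 / ε ^ 2 := by field_simp; ring
  rw [this]
  have : 0 ≤ Real.sinh u ^ 2 / ε ^ 2 := by positivity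
  nlinarith

lemma aux_den_eq (s ε u : ℝ) (hs : s = 1 ∨ s = -1) (hε : 0 < ε) :
    ((Real.sinh u : ℂ) - s * Complex.I * ε) * ((Real.sinh u : ℂ) + s * Complex.I * ε)
      = ((Real.sinh u ^ 2 + ε ^ 2 : ℝ) : ℂ) := by
  have h : (s : ℂ) ^ 2 = 1 := by rcases hs with rfl | rfl <;> norm_num
  push_cast
  linear_combination (-(s:ℂ)^2 * ε ^ 2) * Complex.I_sq + ε ^ 2 * h

lemma aux_ne (s ε u : ℝ) (hs : s = 1 ∨ s = -1) (hε : 0 < ε) :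
    ((Real.sinh u : ℂ) - s * Complex.I * ε) ≠ 0 := by
  intro h
  have h2 := aux_den_eq s ε u hs hε
  rw [h, zero_mul] at h2
  exact (aux_den ε u hε).ne (by exact_mod_cast h2)

lemma aux_integrable (a s : ℝ) (hs : s = 1 ∨ s = -1) (ε : ℝ) (hε : 0 < ε) :
    Integrable (fun u : ℝ =>
        Complex.exp (Complex.I * a * u) / ((Real.sinh u : ℂ) - s * Complex.I * ε)) := by
  refine Integrable.mono' (aux_cosh_int.const_mul (1 + 1 / ε)) ?_ (Eventually.of_forall fun u => ?_)
  · refine Continuous.aestronglyMeasurable (Continuous.div (by fun_prop) ?_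
      fun u => aux_ne s ε u hs hε)
    exact (Complex.continuous_ofReal.comp Real.continuous_sinh).sub continuous_const
  · have h1 : ‖Complex.exp (Complex.I * a * u)‖ = 1 := by
      rw [Complex.norm_exp]; simp
    rw [norm_div, h1, ← div_eq_mul_inv,
      div_le_div_iff₀ (norm_pos_iff.2 (aux_ne s ε u hs hε)) (Real.cosh_pos u)]
    have hre : |Real.sinh u| ≤ ‖(Real.sinh u : ℂ) - s * Complex.I * ε‖ := by
      have := Complex.abs_re_le_norm ((Real.sinh u : ℂ) - s * Complex.I * ε)
      simpa [-Complex.ofReal_sinh] using this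
    have him : ε ≤ ‖(Real.sinh u : ℂ) - s * Complex.I * ε‖ := by
      have := Complex.abs_im_le_norm ((Real.sinh u : ℂ) - s * Complex.I * ε)
      rcases hs with rfl | rfl <;> simpa [-Complex.ofReal_sinh, abs_of_pos hε] using this
    have hc : Real.cosh u ≤ 1 + |Real.sinh u| := by
      refine abs_le_of_sq_le_sq' ?_ (by positivity) |>.2
      nlinarith [Real.cosh_sq u, sq_abs (Real.sinh u), abs_nonneg (Real.sinh u)]
    set N := ‖(Real.sinh u : ℂ) - s * Complex.I * ε‖
    have : 1 ≤ 1 / ε * N := by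
      rw [one_div, ← div_eq_inv_mul, le_div_iff₀ hε]; linarith
    nlinarith

lemma aux_point (a s ε u : ℝ) (hs : s = 1 ∨ s = -1) (hε : 0 < ε) :
    Complex.exp (Complex.I * a * u) / ((Real.sinh u : ℂ) - s * Complex.I * ε) +
    Complex.exp (Complex.I * a * (-u : ℝ)) / ((Real.sinh (-u) : ℂ) - s * Complex.I * ε) =
    2 * Complex.I * (s * ((Real.cos (a * u) * ε / (Real.sinh u ^ 2 + ε ^ 2) : ℝ) : ℂ) +
      ((Real.sin (a * u) * Real.sinh u / (Real.sinh u ^ 2 + ε ^ 2) : ℝ) : ℂ)) := by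
  have h1 := aux_den_eq s ε u hs hε
  have h2 := aux_ne s ε u hs hε
  have h3 := aux_ne s ε (-u) hs hε
  have hd : ((Real.sinh u ^ 2 + ε ^ 2 : ℝ) : ℂ) ≠ 0 := by
    exact_mod_cast (aux_den ε u hε).ne'
  have e1 : Complex.exp (Complex.I * a * u) = Real.cos (a * u) + Real.sin (a * u) * Complex.I := by
    rw [show Complex.I * a * u = ((a * u : ℝ) : ℂ) * Complex.I by push_cast; ring, Complex.exp_mul_I]
    push_cast; rfl
  have e2 : Complex.exp (Complex.I * a * (-u : ℝ)) =
      Real.cos (a * u) - Real.sin (a * u) * Complex.I := by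
    rw [show Complex.I * a * (-u : ℝ) = ((-(a * u) : ℝ) : ℂ) * Complex.I by push_cast; ring,
      Complex.exp_mul_I, ← Complex.ofReal_cos, ← Complex.ofReal_sin, Real.cos_neg, Real.sin_neg]
    push_cast; ring
  have h4 : ((Real.sinh u : ℂ) + s * Complex.I * ε) ≠ 0 := by
    intro h; rw [h, mul_zero] at h1; exact hd h1.symm
  rw [e1, e2, Real.sinh_neg, Complex.ofReal_div, Complex.ofReal_div, ← h1, Complex.ofReal_neg,
    show -(Real.sinh u : ℂ) - s * Complex.I * ε = -((Real.sinh u : ℂ) + s * Complex.I * ε) by ring]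
  simp only [Complex.ofReal_mul]
  rw [show ∀ X : ℂ, 2 * Complex.I * (s * (Real.cos (a * u) * ε / X) +
    Real.sin (a * u) * Real.sinh u / X) = (2 * Real.cos (a * u) * (s * Complex.I * ε) +
      2 * Complex.I * Real.sin (a * u) * Real.sinh u) / X from fun X => by ring]
  generalize (s : ℂ) * Complex.I * ε = P at *
  generalize (Real.sinh u : ℂ) = S at *
  generalize (Real.cos (a * u) : ℂ) = C at *
  generalize (Real.sin (a * u) : ℂ) = D at *
  field_simp
  ring

lemma aux_integral (a s : ℝ) (hs : s = 1 ∨ s = -1) (ε : ℝ) (hε : 0 < ε) :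
    ∫ u : ℝ, Complex.exp (Complex.I * a * u) / ((Real.sinh u : ℂ) - s * Complex.I * ε) =
    Complex.I * (s * ((∫ u : ℝ, Real.cos (a * u) * ε / (Real.sinh u ^ 2 + ε ^ 2) : ℝ) : ℂ) +
      ((∫ u : ℝ, Real.sin (a * u) * Real.sinh u / (Real.sinh u ^ 2 + ε ^ 2) : ℝ) : ℂ)) := by
  set f : ℝ → ℂ := fun u =>
    Complex.exp (Complex.I * a * u) / ((Real.sinh u : ℂ) - s * Complex.I * ε) with hf
  have hfi : Integrable f := aux_integrable a s hs ε hε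
  have h1 : ∫ u, f (-u) = ∫ u, f u := integral_neg_eq_self f volume
  have h2 : ∫ u, (f u + f (-u)) = 2 * ∫ u, f u := by
    rw [integral_add hfi hfi.comp_neg, h1]; ring
  have hi2 : Integrable (fun u : ℝ => Real.sin (a * u) * Real.sinh u / (Real.sinh u ^ 2 + ε ^ 2)) :=
    (aux_cosh_int.const_mul (|a| + 1)).mono' (aux_meas2 a ε hε).aestronglyMeasurable
      (Eventually.of_forall fun u => aux_bound2 a ε u hε)
  have hi1 : Integrable (fun u : ℝ => Real.cos (a * u) * ε / (Real.sinh u ^ 2 + ε ^ 2)) := by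
    refine (aux_cosh_int.const_mul (ε * (1 + 1 / ε ^ 2))).mono' (Continuous.aestronglyMeasurable
      (Continuous.div (by fun_prop) (by fun_prop) fun u => (aux_den ε u hε).ne'))
      (Eventually.of_forall fun u => ?_)
    rw [norm_div, norm_mul, Real.norm_of_nonneg hε.le, Real.norm_of_nonneg (aux_den ε u hε).le,
      div_eq_mul_inv]
    have hc := Real.one_le_cosh u
    have h5 : (Real.cosh u ^ 2)⁻¹ ≤ (Real.cosh u)⁻¹ := by
      apply inv_anti₀ (by linarith); nlinarith
    have h6 := aux_inv ε u hε
    have h7 : ‖Real.cos (a * u)‖ ≤ 1 := Real.abs_cos_le_one _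
    calc ‖Real.cos (a * u)‖ * ε * (Real.sinh u ^ 2 + ε ^ 2)⁻¹
        ≤ 1 * ε * ((1 + 1 / ε ^ 2) * (Real.cosh u)⁻¹) := by
          have := aux_den ε u hε
          gcongr
          exact h6.trans (by gcongr)
      _ = _ := by ring
  have h3 : ∫ u, (f u + f (-u)) = 2 * (Complex.I * (s * ((∫ u : ℝ, Real.cos (a * u) * ε / (Real.sinh u ^ 2 + ε ^ 2) : ℝ) : ℂ) +
      ((∫ u : ℝ, Real.sin (a * u) * Real.sinh u / (Real.sinh u ^ 2 + ε ^ 2) : ℝ) : ℂ))) := by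
    have : ∀ u, f u + f (-u) = _ := fun u => aux_point a s ε u hs hε
    simp_rw [this]
    rw [integral_const_mul, integral_add (hi1.ofReal.const_mul _) hi2.ofReal, integral_const_mul,
      integral_complex_ofReal, integral_complex_ofReal]
    ring
  have := h2.symm.trans h3
  exact mul_left_cancel₀ two_ne_zero this

/-- For every `a ∈ ℝ` and sign `s ∈ {1, -1}`, the integrand
`u ↦ e^{iau}/(sinh u − s·iε)` is integrable for each `ε > 0` and
`(1/(iπ)) ∫ e^{iau}/(sinh u − s·iε) du → s + tanh(πa/2)` as `ε ↓ 0`. -/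
theorem stmt14 (a s : ℝ) (hs : s = 1 ∨ s = -1) :
    (∀ ε : ℝ, 0 < ε →
      Integrable (fun u : ℝ =>
        Complex.exp (Complex.I * a * u) / ((Real.sinh u : ℂ) - s * Complex.I * ε))) ∧
    Tendsto (fun ε : ℝ =>
        (1 / (Complex.I * (Real.pi : ℂ))) *
          ∫ u : ℝ, Complex.exp (Complex.I * a * u) / ((Real.sinh u : ℂ) - s * Complex.I * ε))
      (nhdsWithin 0 (Set.Ioi 0))
      (nhds ((s : ℂ) + (Real.tanh (Real.pi * a / 2) : ℂ))) := by
  refine ⟨fun ε hε => aux_integrable a s hs ε hε, ?_⟩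
  have h1 := (Complex.continuous_ofReal.tendsto _).comp (aux_lim1 a)
  have h2 := (Complex.continuous_ofReal.tendsto _).comp (aux_lim2 a)
  have h3 := (((h1.const_mul (s : ℂ)).add h2).const_mul Complex.I).const_mul
    (1 / (Complex.I * (Real.pi : ℂ)))
  have hpi : (Real.pi : ℂ) ≠ 0 := by exact_mod_cast Real.pi_ne_zero
  have e : (s : ℂ) + (Real.tanh (Real.pi * a / 2) : ℂ) = 1 / (Complex.I * (Real.pi : ℂ)) *
      (Complex.I * (s * ((Real.pi : ℝ) : ℂ) +
        ((Real.pi * Real.tanh (Real.pi * a / 2) : ℝ) : ℂ))) := by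
    rw [Complex.ofReal_mul]
    have := Complex.I_ne_zero
    field_simp
  rw [e]
  refine h3.congr' ?_
  filter_upwards [self_mem_nhdsWithin] with ε hε
  rw [aux_integral a s hs ε hε]
  rfl
end
end
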